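/- Let x be K-sparse with support T, y = Φx, and T^k ⊆ {1,…,n} with |T^k| = Lk. Let x^k minimize ‖y − Φu‖₂ over u supported on T^k and r^k = y − Φx^k. If δ_{K+Lk} < 1, then max over sets S of size L ≤ K of ‖Φ_S' r^k‖₂² ≥ (L(1−δ_{K+Lk})²)/(K(1+δ_{K+Lk})) ‖r^k‖₂². -/

import Mathlib

open Finset Matrix

/-- Squared-entries `ℓ₂` norm of a finite real vector. -/
noncomputable def l2 {ι : Type*} [Fintype ι] (x : ι → ℝ) : ℝ :=
  Real.sqrt (∑ i, x i ^ 2)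

/-- A vector is `K`-sparse if it has at most `K` nonzero entries. -/
def Ksparse {n : ℕ} (K : ℕ) (x : Fin n → ℝ) : Prop :=
  (Finset.univ.filter (fun i => x i ≠ 0)).card ≤ K

/-- `δ` is a valid restricted isometry constant of order `K` for `Φ`. -/
def RIP {m n : ℕ} (Φ : Matrix (Fin m) (Fin n) ℝ) (K : ℕ) (δ : ℝ) : Prop :=
  ∀ x : Fin n → ℝ, Ksparse K x →
    (1 - δ) * ∑ i, x i ^ 2 ≤ ∑ i, (Φ.mulVec x) i ^ 2 ∧
    ∑ i, (Φ.mulVec x) i ^ 2 ≤ (1 + δ) * ∑ i, x i ^ 2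

/-- Column submatrix `Φ_S`. -/
def colSub {m n : ℕ} (Φ : Matrix (Fin m) (Fin n) ℝ) (S : Finset (Fin n)) :
    Matrix (Fin m) S ℝ := fun r c => Φ r c

/-- Gram matrix `Φ_S' Φ_S`. -/
noncomputable def gram {m n : ℕ} (Φ : Matrix (Fin m) (Fin n) ℝ) (S : Finset (Fin n)) :
    Matrix S S ℝ := (colSub Φ S)ᵀ * colSub Φ S

/-- Pseudoinverse `Φ_S^† = (Φ_S'Φ_S)⁻¹ Φ_S'` (for `Φ_S` of full column rank). -/
noncomputable def pinv {m n : ℕ} (Φ : Matrix (Fin m) (Fin n) ℝ) (S : Finset (Fin n)) :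
    Matrix S (Fin m) ℝ := (gram Φ S)⁻¹ * (colSub Φ S)ᵀ

/-- Projection `P_S = Φ_S Φ_S^†` onto the span of the columns of `Φ_S`. -/
noncomputable def proj {m n : ℕ} (Φ : Matrix (Fin m) (Fin n) ℝ) (S : Finset (Fin n)) :
    Matrix (Fin m) (Fin m) ℝ := colSub Φ S * pinv Φ S

/-- Projection `P_S^⊥ = I - P_S`. -/
noncomputable def projPerp {m n : ℕ} (Φ : Matrix (Fin m) (Fin n) ℝ) (S : Finset (Fin n)) :
    Matrix (Fin m) (Fin m) ℝ := 1 - proj Φ S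

/-- Among the subsets of size `L` of a finite set, one carries at least the average share of the
sum of a real function. -/
lemma exists_subset_card_mul_sum_le {ι : Type*} [DecidableEq ι] (f : ι → ℝ) (T : Finset ι) :
    ∀ L ≤ T.card, ∃ S ⊆ T, S.card = L ∧ (L : ℝ) * ∑ i ∈ T, f i ≤ T.card * ∑ i ∈ S, f i := by
  induction T using Finset.induction_on_min_value f with
  | empty =>
    intro L hL
    refine ⟨∅, subset_rfl, ?_, ?_⟩
    · simpa [eq_comm] using hL
    · simp
  | insert a s ha hmin ih =>
    intro L hL
    rw [card_insert_of_notMem ha] at hL ⊢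
    obtain rfl | hL' := Nat.eq_or_lt_of_le hL
    · exact ⟨insert a s, subset_rfl, card_insert_of_notMem ha, le_rfl⟩
    · obtain ⟨S, hS, hcard, hle⟩ := ih L (Nat.lt_succ_iff.mp hL')
      refine ⟨S, hS.trans (subset_insert a s), hcard, ?_⟩
      have h := S.card_nsmul_le_sum f (f a) fun i hi => hmin i (hS hi)
      rw [hcard, nsmul_eq_mul] at h
      rw [sum_insert ha]
      push_cast
      linarith

lemma l2_sq {ι : Type*} [Fintype ι] (x : ι → ℝ) : l2 x ^ 2 = ∑ i, x i ^ 2 :=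
  Real.sq_sqrt (sum_nonneg fun _ _ => sq_nonneg _)

lemma l2_sq_colSub_transpose_mulVec {m n : ℕ} (Φ : Matrix (Fin m) (Fin n) ℝ)
    (S : Finset (Fin n)) (r : Fin m → ℝ) :
    l2 ((colSub Φ S)ᵀ.mulVec r) ^ 2 = ∑ j ∈ S, (Φᵀ.mulVec r) j ^ 2 := by
  rw [l2_sq, ← sum_coe_sort S]
  rfl

/-- The residual of a least-squares fit is orthogonal to the columns used in the fit. -/
lemma transpose_mulVec_residual_eq_zero {m n : ℕ} (Φ : Matrix (Fin m) (Fin n) ℝ)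
    (S : Finset (Fin n)) (y : Fin m → ℝ) (v : Fin n → ℝ) (hv : ∀ i, i ∉ S → v i = 0)
    (hmin : ∀ u : Fin n → ℝ, (∀ i, i ∉ S → u i = 0) →
      l2 (fun r => y r - Φ.mulVec v r) ≤ l2 (fun r => y r - Φ.mulVec u r))
    {j : Fin n} (hj : j ∈ S) : (Φᵀ.mulVec fun r => y r - Φ.mulVec v r) j = 0 := by
  set c := (Φᵀ.mulVec fun r => y r - Φ.mulVec v r) j with hc
  set b := ∑ i, Φ i j ^ 2
  have hb : 0 ≤ b := sum_nonneg fun _ _ => sq_nonneg _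
  have key : ∀ t : ℝ, 0 ≤ t ^ 2 * b - 2 * t * c := by
    intro t
    have h := hmin (v + Pi.single j t) fun i hi => by
      have hij : i ≠ j := fun h => hi (h ▸ hj)
      simp [hv i hi, hij]
    have h2 := pow_le_pow_left₀ (show 0 ≤ l2 _ from Real.sqrt_nonneg _) h 2
    rw [l2_sq, l2_sq] at h2
    have expand : ∑ i, (y i - Φ.mulVec (v + Pi.single j t) i) ^ 2 =
        ∑ i, (y i - Φ.mulVec v i) ^ 2 + (t ^ 2 * b - 2 * t * c) := by
      rw [hc, mulVec, dotProduct, mul_sum, mul_sum, ← sum_sub_distrib, ← sum_add_distrib]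
      refine sum_congr rfl fun i _ => ?_
      simp only [mulVec_add, Pi.add_apply, mulVec_single, transpose_apply, Pi.smul_apply,
        col_apply, MulOpposite.smul_eq_mul_unop, MulOpposite.unop_op]
      ring
    linarith
  have h := key (c / (b + 1))
  have hb1 : 0 < b + 1 := by linarith
  have h3 : (c / (b + 1)) ^ 2 * b - 2 * (c / (b + 1)) * c
      = -((c / (b + 1)) ^ 2 * (b + 2)) := by
    field_simp
    ring
  rw [h3] at h
  have h4 : (c / (b + 1)) ^ 2 = 0 := by nlinarith [sq_nonneg (c / (b + 1))]
  simpa [hb1.ne'] using h4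

/-- Key step of the convergence-rate analysis: some size-`L` set captures at least a
`L(1-δ)²/(K(1+δ))` fraction of the residual energy. -/
theorem residual_energy_capture {m n : ℕ} (Φ : Matrix (Fin m) (Fin n) ℝ)
    (K L k : ℕ) (hK : 0 < K) (hLK : L ≤ K) (hLn : L ≤ n)
    (x : Fin n → ℝ) (T Tk : Finset (Fin n))
    (hsupp : ∀ i, i ∉ T → x i = 0) (hT : T.card = K) (hTk : Tk.card = L * k)
    (δ : ℝ) (hδ0 : 0 ≤ δ) (hδ1 : δ < 1) (hRIP : RIP Φ (K + L * k) δ)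
    (y : Fin m → ℝ) (hy : y = Φ.mulVec x)
    (xk : Fin n → ℝ) (hxksupp : ∀ i, i ∉ Tk → xk i = 0)
    (hmin : ∀ u : Fin n → ℝ, (∀ i, i ∉ Tk → u i = 0) →
      l2 (fun r => y r - Φ.mulVec xk r) ≤ l2 (fun r => y r - Φ.mulVec u r)) :
    ∃ S : Finset (Fin n), S.card = L ∧
      ((L : ℝ) * (1 - δ) ^ 2) / ((K : ℝ) * (1 + δ)) *
          l2 (fun r => y r - Φ.mulVec xk r) ^ 2 ≤
        l2 ((colSub Φ S)ᵀ.mulVec (fun r => y r - Φ.mulVec xk r)) ^ 2 := by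
  set r : Fin m → ℝ := fun i => y i - Φ.mulVec xk i with hr
  set c := Φᵀ.mulVec r
  have hrz : Φ.mulVec (x - xk) = r := by
    ext i
    simp [hr, hy, mulVec_sub]
  have hc : ∀ j ∈ Tk, c j = 0 := fun j hj =>
    transpose_mulVec_residual_eq_zero Φ Tk y xk hxksupp hmin hj
  have hsparse : Ksparse (K + L * k) (x - xk) := by
    refine (card_le_card fun i hi => ?_).trans ((card_union_le T Tk).trans_eq (by rw [hT, hTk]))
    by_contra hmem
    rw [mem_union, not_or] at hmem
    simp [hsupp i hmem.1, hxksupp i hmem.2] at hi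
  have hlow := (hRIP _ hsparse).1
  rw [hrz] at hlow
  have hinner : ∑ i, r i ^ 2 = ∑ j ∈ T, (x - xk) j * c j := by
    calc ∑ i, r i ^ 2 = r ⬝ᵥ Φ.mulVec (x - xk) := by
          rw [hrz]
          exact sum_congr rfl fun i _ => sq (r i)
      _ = ∑ j, (x - xk) j * c j := by
          rw [dotProduct_mulVec, ← mulVec_transpose, dotProduct_comm, dotProduct]
      _ = ∑ j ∈ T, (x - xk) j * c j := by
          refine (sum_subset (subset_univ T) fun j _ hj => ?_).symm
          by_cases hjk : j ∈ Tk
          · rw [hc j hjk, mul_zero]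
          · simp [hsupp j hj, hxksupp j hjk]
  have hcs := sum_mul_sq_le_sq_mul_sq T (x - xk) c
  rw [← hinner] at hcs
  have hz : ∑ j ∈ T, (x - xk) j ^ 2 ≤ ∑ j, (x - xk) j ^ 2 :=
    sum_le_univ_sum_of_nonneg fun _ => sq_nonneg _
  obtain ⟨S, -, hScard, hS⟩ := exists_subset_card_mul_sum_le (fun j => c j ^ 2) T L (hT ▸ hLK)
  refine ⟨S, hScard, ?_⟩
  rw [l2_sq, l2_sq_colSub_transpose_mulVec]
  rw [hT] at hS
  have hR : 0 ≤ ∑ i, r i ^ 2 := sum_nonneg fun _ _ => sq_nonneg _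
  have hC : 0 ≤ ∑ j ∈ T, c j ^ 2 := sum_nonneg fun _ _ => sq_nonneg _
  have henergy : (1 - δ) * ∑ i, r i ^ 2 ≤ ∑ j ∈ T, c j ^ 2 := by
    obtain hR0 | hRpos := hR.eq_or_lt
    · rw [← hR0, mul_zero]
      exact hC
    · refine le_of_mul_le_mul_right ?_ hRpos
      have hδ : 0 ≤ 1 - δ := by linarith
      calc (1 - δ) * (∑ i, r i ^ 2) * ∑ i, r i ^ 2 = (1 - δ) * (∑ i, r i ^ 2) ^ 2 := by ring
        _ ≤ (1 - δ) * ((∑ j, (x - xk) j ^ 2) * ∑ j ∈ T, c j ^ 2) := by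
            gcongr
            exact hcs.trans (by gcongr)
        _ = (1 - δ) * (∑ j, (x - xk) j ^ 2) * ∑ j ∈ T, c j ^ 2 := by ring
        _ ≤ (∑ i, r i ^ 2) * ∑ j ∈ T, c j ^ 2 := by gcongr
        _ = _ := mul_comm _ _
  have hKpos : (0 : ℝ) < K := Nat.cast_pos.mpr hK
  have hδpos : 0 < 1 + δ := by linarith
  rw [div_mul_eq_mul_div, div_le_iff₀ (by positivity)]
  calc (L : ℝ) * (1 - δ) ^ 2 * ∑ i, r i ^ 2
      = L * ((1 - δ) * ((1 - δ) * ∑ i, r i ^ 2)) := by ring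
    _ ≤ L * ((1 + δ) * ∑ j ∈ T, c j ^ 2) := by
        gcongr ?_ * ?_
        exact mul_le_mul (by linarith) henergy (mul_nonneg (by linarith) hR) hδpos.le
    _ = (1 + δ) * (L * ∑ j ∈ T, c j ^ 2) := by ring
    _ ≤ (1 + δ) * (K * ∑ j ∈ S, c j ^ 2) := by gcongr
    _ = (∑ j ∈ S, c j ^ 2) * (K * (1 + δ)) := by ring
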